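/- For every polyomino chain PC_n with n ≥ 2 squares, ZC1(PC_n) < ZC2(PC_n). -/

import Mathlib

noncomputable section
open scoped Classical
open Finset

/-- Taxicab (L¹) distance between two lattice points. -/
def taxicab (u v : ℤ × ℤ) : ℕ := (u.1 - v.1).natAbs + (u.2 - v.2).natAbs

/-- `c 0, …, c (n-1)` are the lower-left corners of the `n` unit squares of a
polyomino chain: the cells are pairwise distinct and two cells share a common
edge (i.e. their lower-left corners are at taxicab distance 1) iff they are
consecutive in the chain, so that the centers of the squares form a path. -/
def IsPolyominoChain (n : ℕ) (c : ℕ → ℤ × ℤ) : Prop :=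
  (∀ i j, i < n → j < n → c i = c j → i = j) ∧
  (∀ i j, i < n → j < n → (taxicab (c i) (c j) = 1 ↔ (i = j + 1 ∨ j = i + 1)))

/-- `v` is a corner of the unit square with lower-left corner `s`. -/
def IsSquareCorner (s v : ℤ × ℤ) : Prop :=
  v = s ∨ v = s + (1, 0) ∨ v = s + (0, 1) ∨ v = s + (1, 1)

/-- The vertex set of the graph of a polyomino chain: all corners of its squares. -/
def corners (n : ℕ) (c : ℕ → ℤ × ℤ) : Finset (ℤ × ℤ) :=
  (Finset.range n).biUnion fun i => {c i, c i + (1, 0), c i + (0, 1), c i + (1, 1)}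

/-- The graph of a polyomino chain: vertices are corners of the squares, and
two corners are adjacent iff they are the endpoints of a unit side of one of
the squares of the chain. -/
def chainGraph (n : ℕ) (c : ℕ → ℤ × ℤ) : SimpleGraph (ℤ × ℤ) :=
  SimpleGraph.fromRel fun u v =>
    taxicab u v = 1 ∧ ∃ i < n, IsSquareCorner (c i) u ∧ IsSquareCorner (c i) v

/-- `tau n c v` = number of vertices of the chain graph at graph distance exactly 2 from `v`. -/
def tau (n : ℕ) (c : ℕ → ℤ × ℤ) (v : ℤ × ℤ) : ℕ :=
  ((corners n c).filter fun u => (chainGraph n c).dist v u = 2).card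

/-- First Zagreb connection index `ZC1 = ∑_{v ∈ V} τ_v²`. -/
def ZC1 (n : ℕ) (c : ℕ → ℤ × ℤ) : ℕ := ∑ v ∈ corners n c, tau n c v ^ 2

/-- Second Zagreb connection index `ZC2 = ∑_{uv ∈ E} τ_u · τ_v`
(each edge appears twice in the double sum, whence the division by 2). -/
def ZC2 (n : ℕ) (c : ℕ → ℤ × ℤ) : ℕ :=
  (∑ u ∈ corners n c, ∑ v ∈ corners n c,
      if (chainGraph n c).Adj u v then tau n c u * tau n c v else 0) / 2

/-- The link `L_k` (for `3 ≤ k ≤ n`) of a polyomino chain: `1` if the `k`-th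
square continues the current straight segment, `2` if it is attached at a kink. -/
def link (c : ℕ → ℤ × ℤ) (k : ℕ) : ℕ :=
  if c (k - 1) - c (k - 2) = c (k - 2) - c (k - 3) then 1 else 2

/-- Indicator of a proposition, as an integer. -/
def ind (P : Prop) : ℤ := if P then 1 else 0

/-- The chain `c` with `n` squares has `m` segments, of lengths `l 1, …, l m`:
there are cut positions `2 = k 0 < k 1 < ⋯ < k (m-1) < k m = n+1` such that the
kink links (links equal to 2) are exactly at positions `k 1, …, k (m-1)`, and the
`j`-th segment has length `l j = k j - k (j-1) + 1`. -/
def HasSegments (n : ℕ) (c : ℕ → ℤ × ℤ) (m : ℕ) (l : ℕ → ℕ) : Prop :=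
  ∃ k : ℕ → ℕ, k 0 = 2 ∧ k m = n + 1 ∧
    (∀ j, 1 ≤ j → j ≤ m → k (j - 1) < k j) ∧
    (∀ x, 3 ≤ x → x ≤ n → (link c x = 2 ↔ ∃ j, 1 ≤ j ∧ j ≤ m - 1 ∧ k j = x)) ∧
    (∀ j, 1 ≤ j → j ≤ m → l j = k j - k (j - 1) + 1)

/-- The chain `c` with `n` squares has link sequence `L_3, …, L_n`. -/
def HasLinks (n : ℕ) (c : ℕ → ℤ × ℤ) (L : ℕ → ℕ) : Prop :=
  ∀ k, 3 ≤ k → k ≤ n → link c k = L k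

/-- The linear chain `Li_n` (all links equal to 1). -/
def linCell : ℕ → ℤ × ℤ := fun i => ((i : ℤ), 0)

/-- The zigzag chain `Z_n` (all links equal to 2). -/
def zigCell : ℕ → ℤ × ℤ := fun i => ((((i + 1) / 2 : ℕ) : ℤ), ((i / 2 : ℕ) : ℤ))

theorem ind_nonneg (p : Prop) : 0 ≤ ind p := by
  unfold ind; split_ifs <;> norm_num

theorem ind_le_one (p : Prop) : ind p ≤ 1 := by
  unfold ind; split_ifs <;> norm_num

/-- The unit segment from `(x, y)` to `(x + 1, y)` is a side of a cell of `P`. -/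
def horizontalEdge (P : ℤ → ℤ → Prop) (x y : ℤ) : Prop := P x y ∨ P x (y - 1)
def verticalEdge (P : ℤ → ℤ → Prop) (x y : ℤ) : Prop := P x y ∨ P (x - 1) y
def localTau (P : ℤ → ℤ → Prop) (x y : ℤ) : ℤ :=
  ind (horizontalEdge P x y ∧ horizontalEdge P (x + 1) y) +
  ind (horizontalEdge P (x - 1) y ∧ horizontalEdge P (x - 2) y) +
  ind (verticalEdge P x y ∧ verticalEdge P x (y + 1)) +
  ind (verticalEdge P x (y - 1) ∧ verticalEdge P x (y - 2)) +
  ind (horizontalEdge P x y ∧ verticalEdge P (x + 1) y ∨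
    verticalEdge P x y ∧ horizontalEdge P x (y + 1)) +
  ind (horizontalEdge P x y ∧ verticalEdge P (x + 1) (y - 1) ∨
    verticalEdge P x (y - 1) ∧ horizontalEdge P x (y - 1)) +
  ind (horizontalEdge P (x - 1) y ∧ verticalEdge P (x - 1) y ∨
    verticalEdge P x y ∧ horizontalEdge P (x - 1) (y + 1)) +
  ind (horizontalEdge P (x - 1) y ∧ verticalEdge P (x - 1) (y - 1) ∨
    verticalEdge P x (y - 1) ∧ horizontalEdge P (x - 1) (y - 1))


/-- The contribution of a corner of value `t` of a cell, whose neighbours along the two sides of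
the cell have values `a` and `b`; `p` and `q` say whether the cells across these sides are
occupied and `r` whether the diagonally opposite cell at the corner is. -/
def cornerTerm (p q r : Prop) (t a b : ℤ) : ℤ :=
  (2 - ind p) * (t * a) + (2 - ind q) * (t * b) -
    (if p ∨ q then 2 * (2 - ind p - ind q) else 2 * (2 - ind r)) * t ^ 2

/-- The total contribution of the cell with lower-left corner `(x, y)`. -/
def cellTerm (P : ℤ → ℤ → Prop) (t : ℤ → ℤ → ℤ) (x y : ℤ) : ℤ :=
  cornerTerm (P x (y - 1)) (P (x - 1) y) (P (x - 1) (y - 1))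
    (t x y) (t (x + 1) y) (t x (y + 1)) +
  cornerTerm (P x (y - 1)) (P (x + 1) y) (P (x + 1) (y - 1))
    (t (x + 1) y) (t x y) (t (x + 1) (y + 1)) +
  cornerTerm (P x (y + 1)) (P (x - 1) y) (P (x - 1) (y + 1))
    (t x (y + 1)) (t (x + 1) (y + 1)) (t x y) +
  cornerTerm (P x (y + 1)) (P (x + 1) y) (P (x + 1) (y + 1))
    (t (x + 1) (y + 1)) (t x (y + 1)) (t (x + 1) y)

theorem straight_arith : ∀ a ∈ Icc (3 : ℤ) 8, ∀ b ∈ Icc (3 : ℤ) 8, ∀ c ∈ Icc (3 : ℤ) 8,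
    ∀ d ∈ Icc (3 : ℤ) 8, a ≤ c + 4 → c ≤ a + 4 → b ≤ d + 4 → d ≤ b + 4 →
      (a - b) ^ 2 + (c - d) ^ 2 < a * c + b * d := by
  decide +kernel

theorem kink_arith : ∀ u ∈ Icc (3 : ℤ) 8, ∀ v ∈ Icc (3 : ℤ) 8, ∀ w ∈ Icc (3 : ℤ) 8,
    ∀ x ∈ Icc (3 : ℤ) 5, v ≤ u + 4 → (v - x) ^ 2 + (w - x) ^ 2 < u * (v + w) := by
  decide +kernel

theorem kink_touch_arith : ∀ u ∈ Icc (3 : ℤ) 8, ∀ v ∈ Icc (3 : ℤ) 8, ∀ w ∈ Icc (3 : ℤ) 8,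
    ∀ x ∈ Icc (4 : ℤ) 8, (v - x) ^ 2 + (w - x) ^ 2 < u * (v + w) + x ^ 2 := by
  decide +kernel

theorem end_touch_arith : ∀ u ∈ Icc (4 : ℤ) 8, ∀ v ∈ Icc (2 : ℤ) 8, ∀ u' ∈ Icc (4 : ℤ) 8,
    ∀ v' ∈ Icc (4 : ℤ) 5, (u - u') ^ 2 + (v - v') ^ 2 + (u' - v') ^ 2 < u * v + u' ^ 2 := by
  decide +kernel

theorem end_touch_touch_arith : ∀ u ∈ Icc (3 : ℤ) 8, ∀ v ∈ Icc (3 : ℤ) 8,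
    ∀ u' ∈ Icc (4 : ℤ) 8, ∀ v' ∈ Icc (4 : ℤ) 8,
      (u - u') ^ 2 + (v - v') ^ 2 + (u' - v') ^ 2 < u * v + u' ^ 2 + v' ^ 2 := by
  decide +kernel

theorem end_bent_arith : ∀ u ∈ Icc (3 : ℤ) 7, ∀ v ∈ Icc (3 : ℤ) 5,
    (u - 3) ^ 2 + (v - 2) ^ 2 + 1 < u * v := by
  decide +kernel

theorem end_flat_arith : ∀ u ∈ Icc (2 : ℤ) 5, ∀ v ∈ Icc (2 : ℤ) 5,
    (u - 2) ^ 2 + (v - 2) ^ 2 < u * v := by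
  decide +kernel

theorem localTau_le_eight (P : ℤ → ℤ → Prop) (x y : ℤ) : localTau P x y ≤ 8 := by
  unfold localTau
  linarith [ind_le_one (horizontalEdge P x y ∧ horizontalEdge P (x + 1) y),
   ind_le_one (horizontalEdge P (x - 1) y ∧ horizontalEdge P (x - 2) y),
   ind_le_one (verticalEdge P x y ∧ verticalEdge P x (y + 1)),
   ind_le_one (verticalEdge P x (y - 1) ∧ verticalEdge P x (y - 2)),
   ind_le_one (horizontalEdge P x y ∧ verticalEdge P (x + 1) y ∨
    verticalEdge P x y ∧ horizontalEdge P x (y + 1)),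
   ind_le_one (horizontalEdge P x y ∧ verticalEdge P (x + 1) (y - 1) ∨
    verticalEdge P x (y - 1) ∧ horizontalEdge P x (y - 1)),
   ind_le_one (horizontalEdge P (x - 1) y ∧ verticalEdge P (x - 1) y ∨
    verticalEdge P x y ∧ horizontalEdge P (x - 1) (y + 1)),
   ind_le_one (horizontalEdge P (x - 1) y ∧ verticalEdge P (x - 1) (y - 1) ∨
    verticalEdge P x (y - 1) ∧ horizontalEdge P (x - 1) (y - 1))]

theorem straight_cell (P : ℤ → ℤ → Prop) (h0 : P 0 0) (h1 : P 1 0) (h2 : P (-1) 0)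
    (h3 : ¬ P 0 1) (h4 : ¬ P 0 (-1)) : 2 ≤ cellTerm P (localTau P) 0 0 := by
  have hA : 3 + ind (P (-1) 1) ≤ localTau P 0 0 ∧ localTau P 0 0 ≤ 7 + ind (P (-1) (-1)) := by
    norm_num [localTau, horizontalEdge, verticalEdge, h0, h1, h2, h3, h4]
    unfold ind; grind
  have hB : 3 + ind (P 1 1) ≤ localTau P 1 0 ∧ localTau P 1 0 ≤ 7 + ind (P 1 (-1)) := by
    norm_num [localTau, horizontalEdge, verticalEdge, h0, h1, h2, h3, h4]
    unfold ind; grind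
  have hC : 3 + ind (P (-1) (-1)) ≤ localTau P 0 1 ∧ localTau P 0 1 ≤ 7 + ind (P (-1) 1) := by
    norm_num [localTau, horizontalEdge, verticalEdge, h0, h1, h2, h3, h4]
    unfold ind; grind
  have hD : 3 + ind (P 1 (-1)) ≤ localTau P 1 1 ∧ localTau P 1 1 ≤ 7 + ind (P 1 1) := by
    norm_num [localTau, horizontalEdge, verticalEdge, h0, h1, h2, h3, h4]
    unfold ind; grind
  have key := straight_arith (localTau P 0 0) ?_ (localTau P 1 0) ?_ (localTau P 0 1) ?_
    (localTau P 1 1) ?_ (by lia) (by lia) (by lia) (by lia)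
  · norm_num [cellTerm, cornerTerm, h1, h2, h3, h4, ind]
    linarith
  all_goals
    rw [Finset.mem_Icc]
    have := ind_nonneg (P (-1) 1)
    have := ind_nonneg (P (-1) (-1))
    have := ind_nonneg (P 1 1)
    have := ind_nonneg (P 1 (-1))
    exact ⟨by lia, localTau_le_eight _ _ _⟩

theorem kink_cell (P : ℤ → ℤ → Prop) (h0 : P 0 0) (h1 : P 1 0) (h2 : P 0 1)
    (h3 : ¬ P (-1) 0) (h4 : ¬ P 0 (-1)) (h5 : ¬ P 1 1) : 2 ≤ cellTerm P (localTau P) 0 0 := by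
  have hu : 3 + ind (P 1 (-1)) ≤ localTau P 1 1 := by
    norm_num [localTau, horizontalEdge, verticalEdge, h0, h1, h2, h3, h4, h5]
    unfold ind; grind
  have hv : 3 ≤ localTau P 1 0 ∧ localTau P 1 0 ≤ 7 + ind (P 1 (-1)) := by
    norm_num [localTau, horizontalEdge, verticalEdge, h0, h1, h2, h3, h4, h5]
    unfold ind; grind
  have hw : 3 ≤ localTau P 0 1 := by
    norm_num [localTau, horizontalEdge, verticalEdge, h0, h1, h2, h3, h4, h5]
    unfold ind; grind
  have hp := ind_nonneg (P 1 (-1))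
  have mu : localTau P 1 1 ∈ Icc 3 8 := Finset.mem_Icc.2 ⟨by lia, localTau_le_eight _ _ _⟩
  have mv : localTau P 1 0 ∈ Icc 3 8 := Finset.mem_Icc.2 ⟨hv.1, localTau_le_eight _ _ _⟩
  have mw : localTau P 0 1 ∈ Icc 3 8 := Finset.mem_Icc.2 ⟨hw, localTau_le_eight _ _ _⟩
  by_cases h6 : P (-1) (-1)
  · have hx : 4 ≤ localTau P 0 0 := by
      norm_num [localTau, horizontalEdge, verticalEdge, h0, h1, h2, h3, h4, h5, h6]
      unfold ind; grind
    have key := kink_touch_arith _ mu _ mv _ mw _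
      (Finset.mem_Icc.2 ⟨hx, localTau_le_eight _ _ _⟩)
    norm_num [cellTerm, cornerTerm, h1, h2, h3, h4, h6, ind]
    linarith
  · have hx : 3 ≤ localTau P 0 0 ∧ localTau P 0 0 ≤ 5 := by
      norm_num [localTau, horizontalEdge, verticalEdge, h0, h1, h2, h3, h4, h5, h6]
      unfold ind; grind
    have key := kink_arith _ mu _ mv _ mw _ (Finset.mem_Icc.2 hx) (by lia)
    norm_num [cellTerm, cornerTerm, h1, h2, h3, h4, h6, ind]
    linarith

theorem end_cell_touch (P : ℤ → ℤ → Prop) (h0 : P 0 0) (h1 : P 1 0) (h2 : ¬ P 0 1)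
    (h3 : ¬ P (-1) 0) (h4 : ¬ P 0 (-1)) (h5 : P (-1) (-1))
    (h7 : P (-2) (-1) ∨ P (-1) (-2)) (h8 : P (-1) 1 → P (-2) 1 ∨ P (-1) 2) :
    2 ≤ cellTerm P (localTau P) 0 0 := by
  have hu' : 4 ≤ localTau P 0 0 := by
    norm_num [localTau, horizontalEdge, verticalEdge, h0, h1, h2, h3, h4, h5]
    unfold ind; grind
  have hu : 4 ≤ localTau P 1 0 := by
    norm_num [localTau, horizontalEdge, verticalEdge, h0, h1, h2, h3, h4, h5]
    unfold ind; grind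
  have mu' : localTau P 0 0 ∈ Icc 4 8 := Finset.mem_Icc.2 ⟨hu', localTau_le_eight _ _ _⟩
  by_cases h6 : P (-1) 1
  · have hv : 3 ≤ localTau P 1 1 := by
      norm_num [localTau, horizontalEdge, verticalEdge, h0, h1, h2, h3, h4, h5, h6]
      unfold ind; grind
    have hv' : 4 ≤ localTau P 0 1 := by
      norm_num [localTau, horizontalEdge, verticalEdge, h0, h1, h2, h3, h4, h5, h6]
      unfold ind; grind
    have key := end_touch_touch_arith _
      (Finset.mem_Icc.2 ⟨le_trans (by norm_num) hu, localTau_le_eight _ _ _⟩) _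
      (Finset.mem_Icc.2 ⟨hv, localTau_le_eight _ _ _⟩) _ mu' _
      (Finset.mem_Icc.2 ⟨hv', localTau_le_eight _ _ _⟩)
    norm_num [cellTerm, cornerTerm, h1, h2, h3, h4, h5, h6, ind]
    linarith
  · have hv : 2 ≤ localTau P 1 1 := by
      norm_num [localTau, horizontalEdge, verticalEdge, h0, h1, h2, h3, h4, h5, h6]
      unfold ind; grind
    have hv' : 4 ≤ localTau P 0 1 ∧ localTau P 0 1 ≤ 5 := by
      norm_num [localTau, horizontalEdge, verticalEdge, h0, h1, h2, h3, h4, h5, h6]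
      unfold ind; grind
    have key := end_touch_arith _ (Finset.mem_Icc.2 ⟨hu, localTau_le_eight _ _ _⟩) _
      (Finset.mem_Icc.2 ⟨hv, localTau_le_eight _ _ _⟩) _ mu' _ (Finset.mem_Icc.2 hv')
    norm_num [cellTerm, cornerTerm, h1, h2, h3, h4, h5, h6, ind]
    linarith

theorem end_cell_bent (P : ℤ → ℤ → Prop) (h0 : P 0 0) (h1 : P 1 0) (h2 : ¬ P 0 1)
    (h3 : ¬ P (-1) 0) (h4 : ¬ P 0 (-1)) (h5 : ¬ P (-1) (-1)) (h6 : ¬ P (-1) 1)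
    (h7 : P 1 (-1)) (h8 : ¬ P 1 1) : 2 ≤ cellTerm P (localTau P) 0 0 := by
  have hu' : localTau P 0 0 = 3 := by
    norm_num [localTau, horizontalEdge, verticalEdge, ind, h0, h1, h2, h3, h4, h5, h6, h7, h8]
  have hv' : localTau P 0 1 = 2 := by
    norm_num [localTau, horizontalEdge, verticalEdge, ind, h0, h1, h2, h3, h4, h5, h6, h7, h8]
  have hu : 3 ≤ localTau P 1 0 ∧ localTau P 1 0 ≤ 7 := by
    norm_num [localTau, horizontalEdge, verticalEdge, h0, h1, h2, h3, h4, h5, h6, h7, h8]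
    unfold ind; grind
  have hv : 3 ≤ localTau P 1 1 ∧ localTau P 1 1 ≤ 5 := by
    norm_num [localTau, horizontalEdge, verticalEdge, h0, h1, h2, h3, h4, h5, h6, h7, h8]
    unfold ind; grind
  have key := end_bent_arith _ (Finset.mem_Icc.2 hu) _ (Finset.mem_Icc.2 hv)
  norm_num [cellTerm, cornerTerm, h1, h2, h3, h4, h5, h6, hu', hv', ind]
  linarith

theorem end_cell_flat (P : ℤ → ℤ → Prop) (h0 : P 0 0) (h1 : P 1 0) (h2 : ¬ P 0 1)
    (h3 : ¬ P (-1) 0) (h4 : ¬ P 0 (-1)) (h5 : ¬ P (-1) (-1)) (h6 : ¬ P (-1) 1)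
    (h7 : ¬ P 1 (-1)) (h8 : ¬ P 1 1) : 2 ≤ cellTerm P (localTau P) 0 0 := by
  have hu' : localTau P 0 0 = 2 := by
    norm_num [localTau, horizontalEdge, verticalEdge, ind, h0, h1, h2, h3, h4, h5, h6, h7, h8]
  have hv' : localTau P 0 1 = 2 := by
    norm_num [localTau, horizontalEdge, verticalEdge, ind, h0, h1, h2, h3, h4, h5, h6, h7, h8]
  have hu : 2 ≤ localTau P 1 0 ∧ localTau P 1 0 ≤ 5 := by
    norm_num [localTau, horizontalEdge, verticalEdge, h0, h1, h2, h3, h4, h5, h6, h7, h8]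
    unfold ind; grind
  have hv : 2 ≤ localTau P 1 1 ∧ localTau P 1 1 ≤ 5 := by
    norm_num [localTau, horizontalEdge, verticalEdge, h0, h1, h2, h3, h4, h5, h6, h7, h8]
    unfold ind; grind
  have key := end_flat_arith _ (Finset.mem_Icc.2 hu) _ (Finset.mem_Icc.2 hv)
  norm_num [cellTerm, cornerTerm, h1, h2, h3, h4, h5, h6, hu', hv', ind]
  linarith

theorem localTau_translate (P : ℤ → ℤ → Prop) (a b x y : ℤ) :
    localTau (fun x y ↦ P (a + x) (b + y)) x y = localTau P (a + x) (b + y) := by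
  simp only [localTau, horizontalEdge, verticalEdge, add_assoc, add_sub_assoc]

theorem cellTerm_translate (P : ℤ → ℤ → Prop) (a b : ℤ) :
    cellTerm (fun x y ↦ P (a + x) (b + y)) (localTau fun x y ↦ P (a + x) (b + y)) 0 0 =
      cellTerm P (localTau P) a b := by
  simp [cellTerm, localTau_translate, ← sub_eq_add_neg]

theorem localTau_transpose (P : ℤ → ℤ → Prop) (x y : ℤ) :
    localTau (fun x y ↦ P y x) x y = localTau P y x := by
  simp only [localTau, horizontalEdge, verticalEdge, or_comm]
  ring

theorem cellTerm_transpose (P : ℤ → ℤ → Prop) :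
    cellTerm (fun x y ↦ P y x) (localTau fun x y ↦ P y x) 0 0 = cellTerm P (localTau P) 0 0 := by
  simp only [cellTerm, localTau_transpose, cornerTerm]
  grind

theorem localTau_reflect (P : ℤ → ℤ → Prop) (x y : ℤ) :
    localTau (fun x y ↦ P (-x) y) x y = localTau P (1 - x) y := by
  simp only [localTau, horizontalEdge, verticalEdge, show -x = 1 - x - 1 by ring,
    show -(x + 1) = 1 - x - 2 by ring, show -(x - 1) = 1 - x by ring,
    show -(x - 2) = 1 - x + 1 by ring, show -(x - 1 - 1) = 1 - x + 1 by ring,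
    show -(x + 1 - 1) = 1 - x - 1 by ring, or_comm, and_comm,
    show 1 - x + 1 - 1 = 1 - x by ring, show 1 - x - 1 - 1 = 1 - x - 2 by ring]
  ring

theorem cellTerm_reflect (P : ℤ → ℤ → Prop) :
    cellTerm (fun x y ↦ P (-x) y) (localTau fun x y ↦ P (-x) y) 0 0 =
      cellTerm P (localTau P) 0 0 := by
  norm_num [cellTerm, localTau_reflect, cornerTerm]
  ring

theorem cellTerm_flip (P : ℤ → ℤ → Prop) :
    cellTerm (fun x y ↦ P x (-y)) (localTau fun x y ↦ P x (-y)) 0 0 =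
      cellTerm P (localTau P) 0 0 :=
  (cellTerm_transpose fun x y ↦ P y (-x)).trans <|
    (cellTerm_reflect fun x y ↦ P y x).trans (cellTerm_transpose P)

/-- Every cell of `P` has one or two neighbours in `P`, and `P` has no `2 × 2` block. -/
structure LocallyChain (P : ℤ → ℤ → Prop) : Prop where
  exists_neighbour : ∀ x y, P x y → P (x + 1) y ∨ P (x - 1) y ∨ P x (y + 1) ∨ P x (y - 1)
  neighbours_le_two : ∀ x y, P x y →
    ind (P (x + 1) y) + ind (P (x - 1) y) + ind (P x (y + 1)) + ind (P x (y - 1)) ≤ 2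
  not_block : ∀ x y, ¬ (P x y ∧ P (x + 1) y ∧ P x (y + 1) ∧ P (x + 1) (y + 1))

namespace LocallyChain

theorem transpose {P : ℤ → ℤ → Prop} (h : LocallyChain P) : LocallyChain fun x y ↦ P y x where
  exists_neighbour x y hP := by have := h.exists_neighbour y x hP; tauto
  neighbours_le_two x y hP := by have := h.neighbours_le_two y x hP; linarith
  not_block x y hP := h.not_block y x (by tauto)

theorem reflect {P : ℤ → ℤ → Prop} (h : LocallyChain P) : LocallyChain fun x y ↦ P (-x) y where
  exists_neighbour x y hP := by
    have := h.exists_neighbour _ y hP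
    rw [neg_add', neg_sub', sub_neg_eq_add]
    tauto
  neighbours_le_two x y hP := by
    have := h.neighbours_le_two _ y hP
    rw [neg_add', neg_sub', sub_neg_eq_add]
    linarith
  not_block x y hP := by
    have := h.not_block (-(x + 1)) y
    rw [show -(x + 1) + 1 = -x by ring] at this
    tauto

theorem translate {P : ℤ → ℤ → Prop} (h : LocallyChain P) (a b : ℤ) :
    LocallyChain fun x y ↦ P (a + x) (b + y) where
  exists_neighbour x y hP := by
    simpa only [← add_assoc, ← add_sub_assoc] using h.exists_neighbour _ _ hP
  neighbours_le_two x y hP := by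
    simpa only [← add_assoc, ← add_sub_assoc] using h.neighbours_le_two _ _ hP
  not_block x y := by
    simpa only [← add_assoc, ← add_sub_assoc] using h.not_block (a + x) (b + y)

theorem end_cell {P : ℤ → ℤ → Prop} (h : LocallyChain P) (h0 : P 0 0) (h1 : P 1 0)
    (h2 : ¬ P 0 1) (h3 : ¬ P (-1) 0) (h4 : ¬ P 0 (-1)) : 2 ≤ cellTerm P (localTau P) 0 0 := by
  have hdown := h.exists_neighbour (-1) (-1)
  have hup := h.exists_neighbour (-1) 1
  norm_num [h2, h3, h4] at hdown hup
  by_cases h5 : P (-1) (-1)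
  · exact end_cell_touch P h0 h1 h2 h3 h4 h5 (hdown h5) hup
  by_cases h6 : P (-1) 1
  · rw [← cellTerm_flip]
    apply end_cell_touch <;> simp_all
  have hn := h.neighbours_le_two 1 0 h1
  by_cases h7 : P 1 (-1) <;> by_cases h8 : P 1 1
  · have := ind_nonneg (P 2 0)
    norm_num [ind, h0, h7, h8] at hn this
    lia
  · exact end_cell_bent P h0 h1 h2 h3 h4 h5 h6 h7 h8
  · rw [← cellTerm_flip]
    apply end_cell_bent <;> simpa
  · exact end_cell_flat P h0 h1 h2 h3 h4 h5 h6 h7 h8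

/-- The cases in which the cell at the origin has a neighbour to its right. -/
theorem cell_of_right {P : ℤ → ℤ → Prop} (h : LocallyChain P) (h0 : P 0 0) (h1 : P 1 0) :
    2 ≤ cellTerm P (localTau P) 0 0 := by
  have hn := h.neighbours_le_two 0 0 h0
  norm_num [ind, h1] at hn
  by_cases h2 : P (-1) 0
  · exact straight_cell P h0 h1 h2 (by grind) (by grind)
  by_cases h3 : P 0 1
  · have := h.not_block 0 0
    exact kink_cell P h0 h1 h3 h2 (by grind) (by grind)
  by_cases h4 : P 0 (-1)
  · have := h.not_block 0 (-1)
    have h5 : ¬ P 1 (-1) := by grind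
    rw [← cellTerm_flip]
    apply kink_cell <;> simpa
  exact h.end_cell h0 h1 h3 h2 h4

theorem cell_origin {P : ℤ → ℤ → Prop} (h : LocallyChain P) (h0 : P 0 0) :
    2 ≤ cellTerm P (localTau P) 0 0 := by
  rcases h.exists_neighbour 0 0 h0 with h1 | h1 | h1 | h1
  · exact h.cell_of_right h0 (by simpa using h1)
  · rw [← cellTerm_reflect]
    exact h.reflect.cell_of_right (by simpa using h0) (by simpa using h1)
  · rw [← cellTerm_transpose]
    exact h.transpose.cell_of_right (by simpa using h0) (by simpa using h1)
  · rw [← cellTerm_transpose, ← cellTerm_reflect]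
    exact h.transpose.reflect.cell_of_right (by simpa using h0) (by simpa using h1)

theorem two_le_cellTerm {P : ℤ → ℤ → Prop} (h : LocallyChain P) {x y : ℤ} (h0 : P x y) :
    2 ≤ cellTerm P (localTau P) x y := by
  rw [← cellTerm_translate]
  exact (h.translate x y).cell_origin (by simpa using h0)

end LocallyChain

/-- The cell with lower-left corner `(x, y)` belongs to the chain. -/
def IsCell (n : ℕ) (c : ℕ → ℤ × ℤ) (x y : ℤ) : Prop := ∃ i < n, c i = (x, y)

theorem locallyChain_isCell {n : ℕ} {c : ℕ → ℤ × ℤ} (hn : 2 ≤ n) (hc : IsPolyominoChain n c) :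
    LocallyChain (IsCell n c) := by
  obtain ⟨hinj, hadj⟩ := hc
  have near {i j : ℕ} {x y x' y' : ℤ} (hi : i < n) (hj : j < n) (hx : c i = (x, y))
      (hy : c j = (x', y')) (h : (x - x').natAbs + (y - y').natAbs = 1) :
      i = j + 1 ∨ j = i + 1 := by
    rw [← hadj i j hi hj, taxicab, hx, hy]
    exact h
  have ne {i j : ℕ} {x y x' y' : ℤ} (hx : c i = (x, y)) (hy : c j = (x', y'))
      (h : ¬ (x = x' ∧ y = y')) : i ≠ j := by
    rintro rfl
    exact h (by simpa using hx.symm.trans hy)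
  refine ⟨?_, ?_, ?_⟩
  · rintro x y ⟨i, hi, hx⟩
    obtain ⟨j, hj, hij⟩ : ∃ j < n, i = j + 1 ∨ j = i + 1 := by
      by_cases h : i + 1 < n
      · exact ⟨i + 1, h, by lia⟩
      · exact ⟨i - 1, by lia, by lia⟩
    have h1 := (hadj i j hi hj).2 hij
    obtain ⟨⟨x', y'⟩, hy⟩ : ∃ z, c j = z := ⟨_, rfl⟩
    simp only [taxicab, hx, hy] at h1
    have : (x' = x + 1 ∧ y' = y) ∨ (x' = x - 1 ∧ y' = y) ∨ (x' = x ∧ y' = y + 1) ∨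
        (x' = x ∧ y' = y - 1) := by omega
    rcases this with ⟨rfl, rfl⟩ | ⟨rfl, rfl⟩ | ⟨rfl, rfl⟩ | ⟨rfl, rfl⟩
    · exact Or.inl ⟨j, hj, hy⟩
    · exact Or.inr (Or.inl ⟨j, hj, hy⟩)
    · exact Or.inr (Or.inr (Or.inl ⟨j, hj, hy⟩))
    · exact Or.inr (Or.inr (Or.inr ⟨j, hj, hy⟩))
  · rintro x y ⟨i, hi, hx⟩
    have three {a b a' b' a'' b'' : ℤ} (h : (x - a).natAbs + (y - b).natAbs = 1)
        (h' : (x - a').natAbs + (y - b').natAbs = 1) (h'' : (x - a'').natAbs + (y - b'').natAbs = 1)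
        (e : ¬ (a = a' ∧ b = b')) (e' : ¬ (a = a'' ∧ b = b'')) (e'' : ¬ (a' = a'' ∧ b' = b'')) :
        ¬ (IsCell n c a b ∧ IsCell n c a' b' ∧ IsCell n c a'' b'') := by
      rintro ⟨⟨j, hj, hy⟩, ⟨k, hk, hz⟩, ⟨l, hl, hw⟩⟩
      have := near hi hj hx hy h
      have := near hi hk hx hz h'
      have := near hi hl hx hw h''
      have := ne hy hz e
      have := ne hy hw e'
      have := ne hz hw e''
      omega
    have h1 := three (a := x + 1) (b := y) (a' := x - 1) (b' := y) (a'' := x) (b'' := y + 1)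
      (by omega) (by omega) (by omega) (by omega) (by omega) (by omega)
    have h2 := three (a := x + 1) (b := y) (a' := x - 1) (b' := y) (a'' := x) (b'' := y - 1)
      (by omega) (by omega) (by omega) (by omega) (by omega) (by omega)
    have h3 := three (a := x + 1) (b := y) (a' := x) (b' := y + 1) (a'' := x) (b'' := y - 1)
      (by omega) (by omega) (by omega) (by omega) (by omega) (by omega)
    have h4 := three (a := x - 1) (b := y) (a' := x) (b' := y + 1) (a'' := x) (b'' := y - 1)
      (by omega) (by omega) (by omega) (by omega) (by omega) (by omega)
    unfold ind
    grind
  · rintro x y ⟨⟨i, hi, hx⟩, ⟨j, hj, hy⟩, ⟨k, hk, hz⟩, ⟨l, hl, hw⟩⟩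
    have := near hi hj hx hy (by omega)
    have := near hi hk hx hz (by omega)
    have := near hl hj hw hy (by omega)
    have := near hl hk hw hz (by omega)
    have := ne hx hw (by omega)
    have := ne hy hz (by omega)
    omega

theorem mem_corners {n : ℕ} {c : ℕ → ℤ × ℤ} {x y : ℤ} :
    (x, y) ∈ corners n c ↔ IsCell n c x y ∨ IsCell n c (x - 1) y ∨ IsCell n c x (y - 1) ∨
      IsCell n c (x - 1) (y - 1) := by
  simp only [corners, mem_biUnion, mem_range, mem_insert, mem_singleton, IsCell, ← exists_or,
    ← and_or_left]
  refine exists_congr fun i ↦ and_congr_right fun _ ↦ ?_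
  simp only [Prod.ext_iff, Prod.fst_add, Prod.snd_add]
  omega

theorem isSquareCorner_iff {s v : ℤ × ℤ} :
    IsSquareCorner s v ↔ s.1 ≤ v.1 ∧ v.1 ≤ s.1 + 1 ∧ s.2 ≤ v.2 ∧ v.2 ≤ s.2 + 1 := by
  simp only [IsSquareCorner, Prod.ext_iff, Prod.fst_add, Prod.snd_add]
  omega

theorem chainGraph_adj {n : ℕ} {c : ℕ → ℤ × ℤ} {x y x' y' : ℤ} :
    (chainGraph n c).Adj (x, y) (x', y') ↔
      x' = x + 1 ∧ y' = y ∧ horizontalEdge (IsCell n c) x y ∨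
      x' = x - 1 ∧ y' = y ∧ horizontalEdge (IsCell n c) (x - 1) y ∨
      x' = x ∧ y' = y + 1 ∧ verticalEdge (IsCell n c) x y ∨
      x' = x ∧ y' = y - 1 ∧ verticalEdge (IsCell n c) x (y - 1) := by
  have key : (chainGraph n c).Adj (x, y) (x', y') ↔ taxicab (x, y) (x', y') = 1 ∧
      ∃ i < n, IsSquareCorner (c i) (x, y) ∧ IsSquareCorner (c i) (x', y') := by
    rw [chainGraph, SimpleGraph.fromRel_adj]
    constructor
    · rintro ⟨-, h | ⟨h, i, hi, hv, hu⟩⟩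
      · exact h
      · refine ⟨?_, i, hi, hu, hv⟩
        simp only [taxicab] at h ⊢
        omega
    · intro h
      refine ⟨?_, Or.inl h⟩
      intro e
      rw [Prod.mk.injEq] at e
      simp only [taxicab] at h
      omega
  simp only [key, taxicab, isSquareCorner_iff, horizontalEdge, verticalEdge, IsCell, ← exists_or,
    Prod.ext_iff, ← exists_and_left]
  refine exists_congr fun i ↦ ?_
  by_cases hi : i < n
  · simp only [hi, true_and]
    generalize (c i).1 = a
    generalize (c i).2 = b
    constructor
    · rintro ⟨h, h'⟩
      have hd : x' = x + 1 ∧ y' = y ∨ x' = x - 1 ∧ y' = y ∨ x' = x ∧ y' = y + 1 ∨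
        x' = x ∧ y' = y - 1 := by omega
      omega
    · omega
  · simp [hi]

theorem mem_corners_of_adj {n : ℕ} {c : ℕ → ℤ × ℤ} {u v : ℤ × ℤ}
    (h : (chainGraph n c).Adj u v) : v ∈ corners n c := by
  obtain ⟨x, y⟩ := u
  obtain ⟨x', y'⟩ := v
  rw [chainGraph_adj] at h
  rw [mem_corners]
  unfold horizontalEdge verticalEdge at h
  grind

theorem dist_eq_two_iff {V : Type*} (G : SimpleGraph V) (u v : V) :
    G.dist u v = 2 ↔ u ≠ v ∧ ¬ G.Adj u v ∧ ∃ w, G.Adj u w ∧ G.Adj w v := by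
  rw [SimpleGraph.dist, ENat.toNat_eq_iff two_ne_zero]
  refine G.edist_eq_two_iff.trans ?_
  simp [Set.Nonempty, SimpleGraph.mem_commonNeighbors, G.adj_comm v]

theorem exists_adj_iff {n : ℕ} {c : ℕ → ℤ × ℤ} {x y : ℤ} {p : ℤ × ℤ → Prop} :
    (∃ w, (chainGraph n c).Adj (x, y) w ∧ p w) ↔
      horizontalEdge (IsCell n c) x y ∧ p (x + 1, y) ∨
      horizontalEdge (IsCell n c) (x - 1) y ∧ p (x - 1, y) ∨
      verticalEdge (IsCell n c) x y ∧ p (x, y + 1) ∨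
      verticalEdge (IsCell n c) x (y - 1) ∧ p (x, y - 1) := by
  simp only [Prod.exists, chainGraph_adj]
  constructor
  · rintro ⟨a, b, ⟨rfl, rfl, h⟩ | ⟨rfl, rfl, h⟩ | ⟨rfl, rfl, h⟩ | ⟨rfl, rfl, h⟩, hp⟩ <;> tauto
  · rintro (⟨h, hp⟩ | ⟨h, hp⟩ | ⟨h, hp⟩ | ⟨h, hp⟩)
    · exact ⟨_, _, Or.inl ⟨rfl, rfl, h⟩, hp⟩
    · exact ⟨_, _, Or.inr (Or.inl ⟨rfl, rfl, h⟩), hp⟩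
    · exact ⟨_, _, Or.inr (Or.inr (Or.inl ⟨rfl, rfl, h⟩)), hp⟩
    · exact ⟨_, _, Or.inr (Or.inr (Or.inr ⟨rfl, rfl, h⟩)), hp⟩

theorem sum_eq_of_offsets {s : Finset (ℤ × ℤ)} {p : ℤ × ℤ → Prop} [DecidablePred p] (f : ℤ × ℤ → ℤ)
    (t : Finset (ℤ × ℤ)) (x y : ℤ) (hs : ∀ v, p v → v ∈ s)
    (ht : ∀ a b, p (a, b) → (a - x, b - y) ∈ t) :
    ∑ v ∈ s with p v, f v = ∑ d ∈ t, ind (p (x + d.1, y + d.2)) * f (x + d.1, y + d.2) := by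
  simp only [ind, ite_mul, one_mul, zero_mul]
  rw [← sum_filter]
  symm
  refine sum_nbij (fun d ↦ (x + d.1, y + d.2)) ?_ ?_ ?_ ?_
  · grind
  · intro d _ e _ h
    simpa [Prod.ext_iff] using h
  · rintro ⟨a, b⟩ h
    rw [coe_filter, Set.mem_ofPred_eq] at h
    refine ⟨(a - x, b - y), ?_, by simp⟩
    simpa using ⟨ht a b h.2, h.2⟩
  · simp

theorem tau_eq_localTau (n : ℕ) (c : ℕ → ℤ × ℤ) (x y : ℤ) :
    (tau n c (x, y) : ℤ) = localTau (IsCell n c) x y := by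
  have hd (u : ℤ × ℤ) := dist_eq_two_iff (chainGraph n c) (x, y) u
  rw [tau, card_eq_sum_ones, Nat.cast_sum,
    Nat.cast_one, sum_eq_of_offsets (fun _ ↦ 1) {(2, 0), (-2, 0), (0, 2), (0, -2), (1, 1), (1, -1), (-1, 1), (-1, -1)} x y]
  · simp only [hd, exists_adj_iff]
    simp [chainGraph_adj, localTau, sub_eq_add_neg, add_assoc]
  · intro v hv
    obtain ⟨-, -, w, -, hw⟩ := (hd v).1 hv
    exact mem_corners_of_adj hw
  · intro a b hab
    rw [hd, exists_adj_iff] at hab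
    simp only [chainGraph_adj] at hab
    simp only [mem_insert, mem_singleton, Prod.mk.injEq]
    grind
theorem sum_adj_eq (n : ℕ) (c : ℕ → ℤ × ℤ) (x y : ℤ) (t : ℤ → ℤ → ℤ) :
    ∑ v ∈ corners n c with (chainGraph n c).Adj (x, y) v, t v.1 v.2 =
      ind (horizontalEdge (IsCell n c) x y) * t (x + 1) y +
      ind (horizontalEdge (IsCell n c) (x - 1) y) * t (x - 1) y +
      ind (verticalEdge (IsCell n c) x y) * t x (y + 1) +
      ind (verticalEdge (IsCell n c) x (y - 1)) * t x (y - 1) := by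
  rw [sum_eq_of_offsets (fun v ↦ t v.1 v.2) {(1, 0), (-1, 0), (0, 1), (0, -1)} x y]
  · simp [chainGraph_adj, ← sub_eq_add_neg, add_assoc, show x + 1 ≠ x - 1 by lia,
      show y + 1 ≠ y - 1 by lia]
  · exact fun v ↦ mem_corners_of_adj
  · intro a b hab
    rw [chainGraph_adj] at hab
    simp only [mem_insert, mem_singleton, Prod.mk.injEq]
    grind

theorem sum_cells_eq (n : ℕ) (c : ℕ → ℤ × ℤ) (a b : ℤ)
    (h : ∀ x y, IsCell n c x y → (x + a, y + b) ∈ corners n c) (f : ℤ → ℤ → ℤ) :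
    ∑ s ∈ (range n).image c, f s.1 s.2 =
      ∑ v ∈ corners n c, ind (IsCell n c (v.1 - a) (v.2 - b)) * f (v.1 - a) (v.2 - b) := by
  simp only [ind, ite_mul, one_mul, zero_mul]
  rw [← sum_filter]
  refine sum_nbij (fun s ↦ (s.1 + a, s.2 + b)) ?_ ?_ ?_ ?_
  · rintro ⟨x, y⟩ hs
    have hs' : IsCell n c x y := by simpa [IsCell] using hs
    simpa using ⟨h x y hs', hs'⟩
  · intro d _ e _ h
    simpa [Prod.ext_iff] using h
  · rintro ⟨x, y⟩ hv
    rw [coe_filter, Set.mem_ofPred_eq] at hv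
    refine ⟨(x - a, y - b), ?_, by simp⟩
    simpa [IsCell] using hv.2
  · simp

/-- The contributions of the cells around a vertex add up to its share of `4 (ZC2 - ZC1)`. -/
theorem vertex_balance (P : ℤ → ℤ → Prop) (t : ℤ → ℤ → ℤ) (x y : ℤ)
    (hv : P x y ∨ P (x - 1) y ∨ P x (y - 1) ∨ P (x - 1) (y - 1))
    (hb : ¬ (P x y ∧ P (x - 1) y ∧ P x (y - 1) ∧ P (x - 1) (y - 1))) :
    ind (P x y) * cornerTerm (P x (y - 1)) (P (x - 1) y) (P (x - 1) (y - 1))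
      (t x y) (t (x + 1) y) (t x (y + 1)) +
    ind (P (x - 1) y) * cornerTerm (P (x - 1) (y - 1)) (P x y) (P x (y - 1))
      (t x y) (t (x - 1) y) (t x (y + 1)) +
    ind (P x (y - 1)) * cornerTerm (P x y) (P (x - 1) (y - 1)) (P (x - 1) y)
      (t x y) (t (x + 1) y) (t x (y - 1)) +
    ind (P (x - 1) (y - 1)) * cornerTerm (P (x - 1) y) (P x (y - 1)) (P x y)
      (t x y) (t (x - 1) y) (t x (y - 1)) =
    2 * (t x y * (ind (horizontalEdge P x y) * t (x + 1) y +
      ind (horizontalEdge P (x - 1) y) * t (x - 1) y +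
      ind (verticalEdge P x y) * t x (y + 1) +
      ind (verticalEdge P x (y - 1)) * t x (y - 1))) - 4 * t x y ^ 2 := by
  unfold horizontalEdge verticalEdge cornerTerm ind
  by_cases h1 : P x y <;> by_cases h2 : P (x - 1) y <;> by_cases h3 : P x (y - 1) <;>
    by_cases h4 : P (x - 1) (y - 1) <;> simp only [h1, h2, h3, h4] at hv hb ⊢ <;> simp <;>
    try ring1
  all_goals simp at hv hb

theorem sum_cellTerm {n : ℕ} {c : ℕ → ℤ × ℤ} (h : LocallyChain (IsCell n c)) (t : ℤ → ℤ → ℤ) :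
    ∑ s ∈ (range n).image c, cellTerm (IsCell n c) t s.1 s.2 =
      2 * ∑ u ∈ corners n c, ∑ v ∈ corners n c with (chainGraph n c).Adj u v,
        t u.1 u.2 * t v.1 v.2 - 4 * ∑ u ∈ corners n c, t u.1 u.2 ^ 2 := by
  have hm (a b : ℤ) (ha : a = 0 ∨ a = 1) (hb : b = 0 ∨ b = 1) (x y : ℤ) (hs : IsCell n c x y) :
      (x + a, y + b) ∈ corners n c := by
    rw [mem_corners]
    rcases ha with rfl | rfl <;> rcases hb with rfl | rfl <;> simp [hs]
  simp only [cellTerm, sum_add_distrib]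
  rw [sum_cells_eq n c 0 0 (hm _ _ (by simp) (by simp)) fun x y ↦
      cornerTerm (IsCell n c x (y - 1)) (IsCell n c (x - 1) y) (IsCell n c (x - 1) (y - 1))
        (t x y) (t (x + 1) y) (t x (y + 1)),
    sum_cells_eq n c 1 0 (hm _ _ (by simp) (by simp)) fun x y ↦
      cornerTerm (IsCell n c x (y - 1)) (IsCell n c (x + 1) y) (IsCell n c (x + 1) (y - 1))
        (t (x + 1) y) (t x y) (t (x + 1) (y + 1)),
    sum_cells_eq n c 0 1 (hm _ _ (by simp) (by simp)) fun x y ↦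
      cornerTerm (IsCell n c x (y + 1)) (IsCell n c (x - 1) y) (IsCell n c (x - 1) (y + 1))
        (t x (y + 1)) (t (x + 1) (y + 1)) (t x y),
    sum_cells_eq n c 1 1 (hm _ _ (by simp) (by simp)) fun x y ↦
      cornerTerm (IsCell n c x (y + 1)) (IsCell n c (x + 1) y) (IsCell n c (x + 1) (y + 1))
        (t (x + 1) (y + 1)) (t x (y + 1)) (t (x + 1) y)]
  rw [mul_sum, mul_sum, ← sum_add_distrib, ← sum_add_distrib, ← sum_add_distrib, ← sum_sub_distrib]
  refine sum_congr rfl ?_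
  rintro ⟨x, y⟩ hv
  rw [mem_corners] at hv
  have hb := h.not_block (x - 1) (y - 1)
  simp only [sub_add_cancel] at hb
  simp only [← mul_sum]
  rw [sum_adj_eq, ← vertex_balance (IsCell n c) t x y hv (by tauto)]
  simp only [sub_add_cancel, sub_zero]

/-- **Remark 2.8(a).** For every polyomino chain with `n ≥ 2` squares,
`ZC1(PC_n) < ZC2(PC_n)`. -/
theorem ZC1_lt_ZC2
    (n : ℕ) (c : ℕ → ℤ × ℤ) (hn : 2 ≤ n) (hc : IsPolyominoChain n c) :
    ZC1 n c < ZC2 n c := by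
  have h := locallyChain_isCell hn hc
  have hcard : #((range n).image c) = n := by
    rw [card_image_of_injOn, card_range]
    intro i hi j hj
    exact hc.1 i j (by simpa using hi) (by simpa using hj)
  have hlower : 2 * (n : ℤ) ≤
      ∑ s ∈ (range n).image c, cellTerm (IsCell n c) (localTau (IsCell n c)) s.1 s.2 := by
    have := card_nsmul_le_sum ((range n).image c)
      (fun s ↦ cellTerm (IsCell n c) (localTau (IsCell n c)) s.1 s.2) 2 fun s hs ↦
        h.two_le_cellTerm (by simpa [IsCell] using hs)
    rw [hcard, nsmul_eq_mul] at this
    linarith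
  rw [sum_cellTerm h] at hlower
  simp only [← tau_eq_localTau, Prod.mk.eta] at hlower
  rw [ZC1, ZC2, Nat.lt_iff_add_one_le, Nat.le_div_iff_mul_le two_pos]
  simp only [← sum_filter]
  zify
  have : (2 : ℤ) ≤ n := by exact_mod_cast hn
  linarith
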